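/- Let N be a finite type of nodes, Φ a finite index type of realizations, p : Φ → ℝ with p(φ) ≥ 0 for all φ and ∑_φ p(φ) = 1, and for each φ a relation ℓ_φ : N → N → Prop. Let S₀ be a finset of N (the currently active nodes) and define F(A) = ∑_{φ} p(φ) · |ρ_φ(A ∪ S₀)|, where ρ_φ(B) = {w | ∃ v ∈ B, Relation.ReflTransGen (ℓ_φ) v w}. Let k : ℕ and let A₀ = ∅, A₁, …, A_k be a greedy chain of finsets disjoint from S₀: for each i < k, A_{i+1} = insert x_i A_i where x_i ∉ A_i ∪ S₀ satisfies F(insert x_i A_i) ≥ F(insert x A_i) for every x ∉ A_i ∪ S₀. Then for every finset A disjoint from S₀ with A.card ≤ k, F(A_k) ≥ (1 − 1/e) · F(A), where e = Real.exp 1. -/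

import Mathlib

/-- The set of nodes reachable from the seed finset `B` via live edges `ℓ`. -/
def reachSet {N : Type*} (ℓ : N → N → Prop) (B : Finset N) : Set N :=
  {w : N | ∃ v ∈ B, Relation.ReflTransGen ℓ v w}

/-- The expected spread, over realizations `φ` with probabilities `p φ`, of
seeding `A` on top of the already-active set `S₀`. -/
noncomputable def expectedSpreadOn {N Φ : Type*} [Fintype Φ] [DecidableEq N]
    (p : Φ → ℝ) (ℓ : Φ → N → N → Prop) (S₀ A : Finset N) : ℝ :=
  ∑ φ : Φ, p φ * ((reachSet (ℓ φ) (A ∪ S₀)).ncard : ℝ)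

theorem reachSet_mono {N : Type*} (ℓ : N → N → Prop) {B C : Finset N} (h : B ⊆ C) :
    reachSet ℓ B ⊆ reachSet ℓ C :=
  fun _ ⟨v, hv, hw⟩ => ⟨v, h hv, hw⟩

theorem reachSet_union {N : Type*} [DecidableEq N] (ℓ : N → N → Prop) (B C : Finset N) :
    reachSet ℓ (B ∪ C) = reachSet ℓ B ∪ reachSet ℓ C := by
  ext w
  simp only [reachSet, Set.mem_ofPred_eq, Set.mem_union, Finset.mem_union, or_and_right,
    exists_or]

theorem ncard_reachSet_submodular {N : Type*} [Finite N] [DecidableEq N] (ℓ : N → N → Prop)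
    (B C : Finset N) :
    (reachSet ℓ (B ∪ C)).ncard + (reachSet ℓ (B ∩ C)).ncard ≤
      (reachSet ℓ B).ncard + (reachSet ℓ C).ncard := by
  rw [reachSet_union, ← Set.ncard_union_add_ncard_inter (reachSet ℓ B) (reachSet ℓ C)]
  gcongr
  · exact Set.toFinite _
  · exact Set.subset_inter (reachSet_mono ℓ Finset.inter_subset_left)
      (reachSet_mono ℓ Finset.inter_subset_right)

section ExpectedSpread

variable {N Φ : Type*} [Fintype Φ] [DecidableEq N] {p : Φ → ℝ}

theorem expectedSpreadOn_nonneg (hp : ∀ φ, 0 ≤ p φ) (ℓ : Φ → N → N → Prop) (S₀ A : Finset N) :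
    0 ≤ expectedSpreadOn p ℓ S₀ A :=
  Finset.sum_nonneg fun φ _ => mul_nonneg (hp φ) (Nat.cast_nonneg _)

theorem expectedSpreadOn_mono [Finite N] (hp : ∀ φ, 0 ≤ p φ) (ℓ : Φ → N → N → Prop)
    (S₀ : Finset N) : Monotone (expectedSpreadOn p ℓ S₀) := by
  intro A B h
  refine Finset.sum_le_sum fun φ _ => mul_le_mul_of_nonneg_left ?_ (hp φ)
  exact_mod_cast Set.ncard_le_ncard
    (reachSet_mono (ℓ φ) (Finset.union_subset_union_left h)) (Set.toFinite _)

theorem expectedSpreadOn_submodular [Finite N] (hp : ∀ φ, 0 ≤ p φ) (ℓ : Φ → N → N → Prop)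
    (S₀ A B : Finset N) :
    expectedSpreadOn p ℓ S₀ (A ∪ B) + expectedSpreadOn p ℓ S₀ (A ∩ B) ≤
      expectedSpreadOn p ℓ S₀ A + expectedSpreadOn p ℓ S₀ B := by
  simp only [expectedSpreadOn, ← Finset.sum_add_distrib, ← mul_add]
  refine Finset.sum_le_sum fun φ _ => mul_le_mul_of_nonneg_left ?_ (hp φ)
  have h := ncard_reachSet_submodular (ℓ φ) (A ∪ S₀) (B ∪ S₀)
  rw [← Finset.union_union_distrib_right, ← Finset.inter_union_distrib_right] at h
  exact_mod_cast h

end ExpectedSpread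

section Submodular

variable {N : Type*} [DecidableEq N] {F : Finset N → ℝ}

/-- If a monotone submodular function gains at most `g` from each single element of `C`, then it
gains at most `C.card * g` from all of `C`. -/
theorem submodular_union_le (hmono : Monotone F)
    (hsub : ∀ A B, F (A ∪ B) + F (A ∩ B) ≤ F A + F B) (A : Finset N) (g : ℝ) (C : Finset N)
    (hC : ∀ y ∈ C, F (insert y A) ≤ F A + g) : F (C ∪ A) ≤ F A + C.card * g := by
  induction C using Finset.induction_on with
  | empty => simp
  | insert y C hy ih =>
    have h := hsub (insert y A) (C ∪ A)
    have hunion : insert y A ∪ (C ∪ A) = insert y C ∪ A := by grind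
    have hinter : F A ≤ F (insert y A ∩ (C ∪ A)) :=
      hmono (Finset.subset_inter (Finset.subset_insert _ _) Finset.subset_union_right)
    have hyA := hC y (Finset.mem_insert_self y C)
    have hCA := ih fun z hz => hC z (Finset.mem_insert_of_mem hz)
    rw [hunion] at h
    rw [Finset.card_insert_of_notMem hy]
    push_cast
    linarith

theorem submodular_greedy_approx (hnonneg : ∀ A, 0 ≤ F A) (hmono : Monotone F)
    (hsub : ∀ A B, F (A ∪ B) + F (A ∩ B) ≤ F A + F B) {k : ℕ} {A : ℕ → Finset N} {B : Finset N}
    (hsucc : ∀ i < k, A i ⊆ A (i + 1))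
    (hgreedy : ∀ i < k, ∀ y ∈ B, y ∉ A i → F (insert y (A i)) ≤ F (A (i + 1)))
    (hB : B.card ≤ k) (hA : k = 0 → B ⊆ A 0) :
    (1 - 1 / Real.exp 1) * F B ≤ F (A k) := by
  rcases Nat.eq_zero_or_pos k with rfl | hk
  · have h0 := hmono (hA rfl)
    have he : 0 ≤ 1 / Real.exp 1 := by positivity
    nlinarith [mul_nonneg he (hnonneg B)]
  have hk1 : (1 : ℝ) ≤ k := by exact_mod_cast hk
  have hq : (0 : ℝ) ≤ 1 - 1 / k := sub_nonneg.2 ((div_le_one (by linarith)).2 hk1)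
  have hgap : ∀ i < k, F B - F (A (i + 1)) ≤ (1 - 1 / k) * (F B - F (A i)) := by
    intro i hi
    have hg : F (A i) ≤ F (A (i + 1)) := hmono (hsucc i hi)
    have h := submodular_union_le hmono hsub (A i) (F (A (i + 1)) - F (A i)) B fun y hy => by
      by_cases hyA : y ∈ A i
      · rw [Finset.insert_eq_of_mem hyA]
        linarith
      · linarith [hgreedy i hi y hy hyA]
    have hBk : (B.card : ℝ) * (F (A (i + 1)) - F (A i)) ≤ k * (F (A (i + 1)) - F (A i)) :=
      mul_le_mul_of_nonneg_right (by exact_mod_cast hB) (sub_nonneg.2 hg)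
    have hFB : F B ≤ F (B ∪ A i) := hmono Finset.subset_union_left
    have hdiv : (F B - F (A i)) / k ≤ F (A (i + 1)) - F (A i) := by
      rw [div_le_iff₀' (by linarith)]
      linarith
    have hexpand : (1 - 1 / (k : ℝ)) * (F B - F (A i)) =
        (F B - F (A i)) - (F B - F (A i)) / k := by ring
    linarith
  have hpow : ∀ i ≤ k, F B - F (A i) ≤ (1 - 1 / k) ^ i * F B := by
    intro i
    induction i with
    | zero => intro _; simpa using hnonneg (A 0)
    | succ i ih =>
      intro hi
      calc F B - F (A (i + 1)) ≤ (1 - 1 / k) * (F B - F (A i)) := hgap i hi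
        _ ≤ (1 - 1 / k) * ((1 - 1 / k) ^ i * F B) :=
          mul_le_mul_of_nonneg_left (ih (by lia)) hq
        _ = (1 - 1 / k) ^ (i + 1) * F B := by ring
  have hexp := mul_le_mul_of_nonneg_right (Real.one_sub_div_pow_le_exp_neg hk1) (hnonneg B)
  rw [Real.exp_neg, ← one_div] at hexp
  linarith [hpow k le_rfl]

end Submodular

/-- Lemma 7: at each step, a greedily constructed seed set of
size `k`, disjoint from the already-active set `S₀`, achieves a
`(1 − 1/e)`-approximation of any seed set disjoint from `S₀` of size at most
`k` for the expected future spread. -/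
theorem greedy_expectedSpread_approx {N Φ : Type*} [Fintype N] [DecidableEq N]
    [Fintype Φ] (p : Φ → ℝ) (hp : ∀ φ, 0 ≤ p φ) (hp1 : ∑ φ : Φ, p φ = 1)
    (ℓ : Φ → N → N → Prop) (S₀ : Finset N)
    (k : ℕ) (A : ℕ → Finset N) (x : ℕ → N)
    (hA0 : A 0 = ∅)
    (hstep : ∀ i < k, x i ∉ A i ∪ S₀ ∧ A (i + 1) = insert (x i) (A i) ∧
      ∀ y : N, y ∉ A i ∪ S₀ →
        expectedSpreadOn p ℓ S₀ (insert (x i) (A i)) ≥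
          expectedSpreadOn p ℓ S₀ (insert y (A i))) :
    ∀ B : Finset N, Disjoint B S₀ → B.card ≤ k →
      expectedSpreadOn p ℓ S₀ (A k) ≥
        (1 - 1 / Real.exp 1) * expectedSpreadOn p ℓ S₀ B := by
  intro B hBS hBk
  refine submodular_greedy_approx (expectedSpreadOn_nonneg hp ℓ S₀) (expectedSpreadOn_mono hp ℓ S₀)
    (expectedSpreadOn_submodular hp ℓ S₀) ?_ ?_ hBk ?_
  · intro i hi
    rw [(hstep i hi).2.1]
    exact Finset.subset_insert _ _
  · intro i hi y hy hyA
    rw [(hstep i hi).2.1]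
    refine (hstep i hi).2.2 y fun h => ?_
    exact (Finset.mem_union.1 h).elim hyA (Finset.disjoint_left.1 hBS hy)
  · rintro rfl
    simp [Finset.card_eq_zero.1 (Nat.le_zero.1 hBk)]
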